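/- Suppose U and V satisfy the (3,4) string equation (S1),(S2) and the KP flow equations (F1)–(F4) at every point of ℝ³, and define h₁(t₅,t₂,x) := H₁(Q_U(t₅,t₂,x),…,P_W(t₅,t₂,x),x,t₂,t₅) and h₂(t₅,t₂,x) := H₂(Q_U(t₅,t₂,x),…,P_W(t₅,t₂,x),x,t₂,t₅), evaluating the polynomials H₁, H₂ along the Darboux coordinates of (U,V). Then for every (t₅,t₂,x) ∈ ℝ³: ∂h₁/∂x = −U and ∂h₂/∂x = 2V. -/

import Mathlib

noncomputable def Ham1 {K : Type*} [Field K] (qU qV qW pU pV pW t1 t2 t5 : K) : K :=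
  pU * qW + 6 * pW ^ 2 - (3/8) * qU * qW ^ 2 + (1/2) * pV ^ 2 - (1/8) * qU ^ 4
    - (3/2) * qU * qV ^ 2 - t1 * qU + 2 * t2 * qV
    + (1/8) * t5 * (16 * qU * pW - 2 * qU ^ 3 + 4 * qV ^ 2 - qW ^ 2)
    - (1/2) * t5 ^ 2 * (4 * pW - qU ^ 2)
    + (19/27) * t5 ^ 3 * qU + (41/54) * t5 ^ 4 - (4/3) * t5 * t1

noncomputable def Ham2 {K : Type*} [Field K] (qU qV qW pU pV pW t1 t2 t5 : K) : K :=
  (1/2) * pV * qU * qW + (1/4) * qV * qW ^ 2 - 2 * pU * pV - 6 * pW * qU * qV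
    + qV ^ 3 + qU ^ 3 * qV + 2 * t1 * qV
    + t2 * (4 * pW - qU ^ 2)
    + (1/2) * t5 * (qV * qU ^ 2 - pV * qW + 4 * qV * pW)
    - 2 * t5 * t2 * qU - (65/27) * t5 ^ 3 * qV - (22/9) * t5 ^ 2 * t2

noncomputable def QUc (U : ℝ → ℝ → ℝ → ℝ) (t5 t2 x : ℝ) : ℝ :=
  U t5 t2 x - (4/3) * t5

noncomputable def QVc (V : ℝ → ℝ → ℝ → ℝ) (t5 t2 x : ℝ) : ℝ :=
  V t5 t2 x

noncomputable def QWc (U : ℝ → ℝ → ℝ → ℝ) (t5 t2 x : ℝ) : ℝ :=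
  deriv (U t5 t2) x

noncomputable def PUc (U : ℝ → ℝ → ℝ → ℝ) (t5 t2 x : ℝ) : ℝ :=
  (1/4) * (3 * U t5 t2 x * deriv (U t5 t2) x - (1/3) * deriv^[3] (U t5 t2) x
    - (7/3) * t5 * deriv (U t5 t2) x)

noncomputable def PVc (V : ℝ → ℝ → ℝ → ℝ) (t5 t2 x : ℝ) : ℝ :=
  deriv (V t5 t2) x

noncomputable def PWc (U : ℝ → ℝ → ℝ → ℝ) (t5 t2 x : ℝ) : ℝ :=
  (1/12) * deriv^[2] (U t5 t2) x - (1/6) * t5 * U t5 t2 x + (7/18) * t5 ^ 2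

theorem ContDiff.hasDerivAt_iterate_deriv {f : ℝ → ℝ} (hf : ContDiff ℝ (⊤ : ℕ∞) f)
    (n : ℕ) (x : ℝ) :
    HasDerivAt (deriv^[n] f) (deriv^[n + 1] f x) x := by
  rw [Function.iterate_succ_apply']
  exact ((hf.iterate_deriv n).differentiable (by simp)).differentiableAt.hasDerivAt

theorem hamiltonian_values_x_derivatives (U V : ℝ → ℝ → ℝ → ℝ)
    (hU : ContDiff ℝ (⊤ : ℕ∞) fun p : ℝ × ℝ × ℝ => U p.1 p.2.1 p.2.2)
    (hV : ContDiff ℝ (⊤ : ℕ∞) fun p : ℝ × ℝ × ℝ => V p.1 p.2.1 p.2.2)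
    (hS1 : ∀ t5 t2 x : ℝ,
      0 = (1/2) * deriv^[2] (V t5 t2) x - (3/2) * U t5 t2 x * V t5 t2 x
        + (5/2) * t5 * V t5 t2 x + t2)
    (hS2 : ∀ t5 t2 x : ℝ,
      0 = (1/12) * deriv^[4] (U t5 t2) x - (3/4) * deriv^[2] (U t5 t2) x * U t5 t2 x
        - (3/8) * (deriv (U t5 t2) x) ^ 2 + (3/2) * (V t5 t2 x) ^ 2 + (1/2) * (U t5 t2 x) ^ 3
        - (5/12) * t5 * (3 * (U t5 t2 x) ^ 2 - deriv^[2] (U t5 t2) x) + x)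
    (hF1 : ∀ t5 t2 x : ℝ, deriv (fun s => U t5 s x) t2 = -2 * deriv (V t5 t2) x)
    (hF2 : ∀ t5 t2 x : ℝ,
      deriv (fun s => V t5 s x) t2 = (1/6) * deriv^[3] (U t5 t2) x - U t5 t2 x * deriv (U t5 t2) x)
    (hF3 : ∀ t5 t2 x : ℝ,
      deriv (fun s => U s t2 x) t5
        = deriv (fun y => -(1/6) * U t5 t2 y * deriv^[2] (U t5 t2) y
            + (1/8) * (deriv (U t5 t2) y) ^ 2 + (1/4) * (U t5 t2 y) ^ 3
            - (1/2) * (V t5 t2 y) ^ 2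
            - (5/9) * t5 * (3 * (U t5 t2 y) ^ 2 - deriv^[2] (U t5 t2) y) + (4/3) * y) x)
    (hF4 : ∀ t5 t2 x : ℝ,
      deriv (fun s => V s t2 x) t5
        = deriv (fun y => (1/12) * deriv^[2] (U t5 t2) y * V t5 t2 y
            - (1/4) * deriv (U t5 t2) y * deriv (V t5 t2) y
            + (5/16) * (U t5 t2 y) ^ 2 * V t5 t2 y
            - ((5/3) * t5 + (1/4) * U t5 t2 y) ^ 2 * V t5 t2 y - t2 * U t5 t2 y) x) :
    ∀ t5 t2 x : ℝ,
      deriv (fun y => Ham1 (QUc U t5 t2 y) (QVc V t5 t2 y) (QWc U t5 t2 y) (PUc U t5 t2 y) (PVc V t5 t2 y) (PWc U t5 t2 y) y t2 t5) x = - U t5 t2 x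
      ∧ deriv (fun y => Ham2 (QUc U t5 t2 y) (QVc V t5 t2 y) (QWc U t5 t2 y) (PUc U t5 t2 y) (PVc V t5 t2 y) (PWc U t5 t2 y) y t2 t5) x = 2 * V t5 t2 x := by
  intro t5 t2 x
  have hu : ContDiff ℝ (⊤ : ℕ∞) (U t5 t2) :=
    hU.comp (contDiff_const.prodMk (contDiff_const.prodMk contDiff_id))
  have hv : ContDiff ℝ (⊤ : ℕ∞) (V t5 t2) :=
    hV.comp (contDiff_const.prodMk (contDiff_const.prodMk contDiff_id))
  have hu0 : HasDerivAt (U t5 t2) (deriv (U t5 t2) x) x := hu.hasDerivAt_iterate_deriv 0 x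
  have hu1 : HasDerivAt (deriv (U t5 t2)) (deriv^[2] (U t5 t2) x) x :=
    hu.hasDerivAt_iterate_deriv 1 x
  have hu2 := hu.hasDerivAt_iterate_deriv 2 x
  have hu3 := hu.hasDerivAt_iterate_deriv 3 x
  have hv0 : HasDerivAt (V t5 t2) (deriv (V t5 t2) x) x := hv.hasDerivAt_iterate_deriv 0 x
  have hv1 : HasDerivAt (deriv (V t5 t2)) (deriv^[2] (V t5 t2) x) x :=
    hv.hasDerivAt_iterate_deriv 1 x
  have hQU : HasDerivAt (QUc U t5 t2) (deriv (U t5 t2) x) x := hu0.sub_const _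
  have hQV : HasDerivAt (QVc V t5 t2) (deriv (V t5 t2) x) x := hv0
  have hQW : HasDerivAt (QWc U t5 t2) (deriv^[2] (U t5 t2) x) x := hu1
  have hPV : HasDerivAt (PVc V t5 t2) (deriv^[2] (V t5 t2) x) x := hv1
  have hPU := ((((hu0.const_mul 3).mul hu1).sub (hu3.const_mul (1/3))).sub
    (hu1.const_mul (7/3 * t5))).const_mul (1/4)
  have hPW := ((hu2.const_mul (1/12)).sub (hu0.const_mul (1/6 * t5))).add_const (7/18 * t5 ^ 2)
  change HasDerivAt (PUc U t5 t2) _ x at hPU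
  change HasDerivAt (PWc U t5 t2) _ x at hPW
  have hx := hasDerivAt_id' x
  have s1 := hS1 t5 t2 x
  have s2 := hS2 t5 t2 x
  constructor
  · have h := ((((((((((((hPU.mul hQW).add ((hPW.pow 2).const_mul 6)).sub
      ((hQU.const_mul (3/8)).mul (hQW.pow 2))).add ((hPV.pow 2).const_mul (1/2))).sub
      ((hQU.pow 4).const_mul (1/8))).sub ((hQU.const_mul (3/2)).mul (hQV.pow 2))).sub
      (hx.mul hQU)).add (hQV.const_mul (2 * t2))).add
      ((((((hQU.const_mul 16).mul hPW).sub ((hQU.pow 3).const_mul 2)).add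
        ((hQV.pow 2).const_mul 4)).sub (hQW.pow 2)).const_mul (1/8 * t5))).sub
      (((hPW.const_mul 4).sub (hQU.pow 2)).const_mul (1/2 * t5 ^ 2))).add
      (hQU.const_mul (19/27 * t5 ^ 3))).add_const (41/54 * t5 ^ 4)).sub
      (hx.const_mul (4/3 * t5))
    refine h.deriv.trans ?_
    simp only [Pi.pow_apply, QUc, QVc, QWc, PUc, PVc, PWc]
    linear_combination deriv (U t5 t2) x * s2 - 2 * deriv (V t5 t2) x * s1
  · have h := ((((((((((((hPV.const_mul (1/2)).mul hQU).mul hQW).add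
      ((hQV.const_mul (1/4)).mul (hQW.pow 2))).sub ((hPU.const_mul 2).mul hPV)).sub
      (((hPW.const_mul 6).mul hQU).mul hQV)).add (hQV.pow 3)).add ((hQU.pow 3).mul hQV)).add
      ((hx.const_mul 2).mul hQV)).add (((hPW.const_mul 4).sub (hQU.pow 2)).const_mul t2)).add
      ((((hQV.mul (hQU.pow 2)).sub (hPV.mul hQW)).add
        ((hQV.const_mul 4).mul hPW)).const_mul (1/2 * t5))).sub
      (hQU.const_mul (2 * t5 * t2))).sub (hQV.const_mul (65/27 * t5 ^ 3))
    refine (h.sub_const (22/9 * t5 ^ 2 * t2)).deriv.trans ?_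
    simp only [Pi.mul_apply, Pi.pow_apply, QUc, QVc, QWc, PUc, PVc, PWc]
    linear_combination (-2 * deriv (V t5 t2) x) * s2
      + (2 * U t5 t2 x * deriv (U t5 t2) x - (1/3) * deriv^[3] (U t5 t2) x) * s1
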